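/- Let V∈ℓ∞(ℤ^d;ℝ) satisfy the non-resonance condition of 𝒱 with constant γ>0. Let N=2^{n_max} with n_max∈ℕ, n_max≥1, let q≥2 be an integer and ν∈(0,1) be such that γ q^{−4}(log₂(2qN))^{−(2q+1)} ≥ ν. If 𝐤,𝐥∈(ℤ^d)^q satisfy |Ω(𝐤,𝐥)| < ν and 𝐤₁+⋯+𝐤_q = 𝐥₁+⋯+𝐥_q, then either μ₂(𝐤,𝐥) ≥ N, or for every n∈ℕ one has #{j∈{1,…,q}:𝐤_j∈B_n} = #{j:𝐥_j∈B_n}. -/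

import Mathlib

open scoped BigOperators

noncomputable section

/-- Index set `ℤ^d`. -/
abbrev Idx (d : ℕ) := Fin d → ℤ

/-- Euclidean norm of `k ∈ ℤ^d`. -/
def zNorm {d : ℕ} (k : Idx d) : ℝ := Real.sqrt (∑ i, ((k i : ℝ)) ^ 2)

/-- The index `n` of the dyadic block `B_n` containing `k`. -/
def blockIdx {d : ℕ} (k : Idx d) : ℕ :=
  if zNorm k < 2 then 0 else Nat.floor (Real.logb 2 (zNorm k))

/-- A pair `(𝐤,𝐥)` is block-unbalanced if for some `n` the numbers of its components in
the dyadic block `B_n` differ. -/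
def Unbalanced {d q : ℕ} (k l : Fin q → Idx d) : Prop :=
  ∃ n : ℕ, (Finset.univ.filter fun j => blockIdx (k j) = n).card ≠
    (Finset.univ.filter fun j => blockIdx (l j) = n).card

/-- The frequencies `ω_k = |k|² + (2π)^{−d/2} V_k`. -/
def freqV {d : ℕ} (V : Idx d → ℝ) (k : Idx d) : ℝ :=
  zNorm k ^ 2 + (2 * Real.pi) ^ (-(d : ℝ) / 2) * V k

/-- The small divisor `Ω(𝐤,𝐥) = 2(ω_{𝐤₁}+⋯+ω_{𝐤_q}−ω_{𝐥₁}−⋯−ω_{𝐥_q})`. -/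
def smallDiv {d q : ℕ} (freq : Idx d → ℝ) (k l : Fin q → Idx d) : ℝ :=
  2 * ((∑ j, freq (k j)) - ∑ j, freq (l j))

/-- `V` satisfies the non-resonance condition of the set `𝒱` with constant `γ > 0`. -/
def NonRes {d : ℕ} (V : Idx d → ℝ) (γ : ℝ) : Prop :=
  ∀ q : ℕ, 2 ≤ q → ∀ k l : Fin q → Idx d, Unbalanced k l →
    γ * ((q : ℝ) ^ 4)⁻¹ *
        (Real.logb 2 (⨆ j : Fin q, max (zNorm (k j)) (zNorm (l j)))) ^ (-(2 * (q : ℝ) + 1))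
      ≤ |smallDiv (freqV V) k l|

/-- `μ₂(𝐤,𝐥)`: the second largest value among `|𝐤₁|,…,|𝐤_q|,|𝐥₁|,…,|𝐥_q|`. -/
def mu2 {d q : ℕ} (k l : Fin q → Idx d) : ℝ :=
  ⨅ i : Fin q ⊕ Fin q, ⨆ j : {j : Fin q ⊕ Fin q // j ≠ i},
    Sum.elim (fun a => zNorm (k a)) (fun a => zNorm (l a)) (j : Fin q ⊕ Fin q)

/-- The Euclidean norm of an integer vector, as the norm of its image in `EuclideanSpace`. -/
lemma zNorm_eq_norm {d : ℕ} (k : Idx d) :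
    zNorm k = ‖(WithLp.toLp 2 fun i => (k i : ℝ) : EuclideanSpace ℝ (Fin d))‖ := by
  simp [zNorm, EuclideanSpace.norm_eq]

lemma zNorm_neg {d : ℕ} (k : Idx d) : zNorm (-k) = zNorm k := by
  simp [zNorm]

lemma zNorm_sum_le {d : ℕ} {ι : Type*} (s : Finset ι) (w : ι → Idx d) :
    zNorm (∑ j ∈ s, w j) ≤ ∑ j ∈ s, zNorm (w j) := by
  simp only [zNorm_eq_norm]
  refine le_trans (le_of_eq ?_) (norm_sum_le _ _)
  congr 1
  ext i
  simp

/-- In a finite family of integer vectors with zero sum, a bound on all members but one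
controls every member. -/
lemma zNorm_le_card_mul_of_sum_eq_zero {d : ℕ} {ι : Type*} [Fintype ι] {w : ι → Idx d}
    (hw : ∑ j, w j = 0) {C : ℝ} (hC : 0 ≤ C) (i : ι) (h : ∀ j, j ≠ i → zNorm (w j) ≤ C) (j : ι) :
    zNorm (w j) ≤ Fintype.card ι * C := by
  classical
  have hcard : (1 : ℝ) ≤ Fintype.card ι := by
    exact_mod_cast Fintype.card_pos_iff.mpr ⟨i⟩
  by_cases hj : j = i
  · subst hj
    have hsplit : w j = -∑ m ∈ Finset.univ.erase j, w m := by
      rw [eq_neg_iff_add_eq_zero, Finset.add_sum_erase _ _ (Finset.mem_univ j), hw]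
    calc zNorm (w j) = zNorm (∑ m ∈ Finset.univ.erase j, w m) := by
          rw [hsplit, zNorm_neg]
      _ ≤ ∑ m ∈ Finset.univ.erase j, zNorm (w m) := zNorm_sum_le _ _
      _ ≤ (Finset.univ.erase j).card • C :=
          Finset.sum_le_card_nsmul _ _ _ fun m hm => h m (Finset.ne_of_mem_erase hm)
      _ ≤ Fintype.card ι * C := by
          rw [nsmul_eq_mul]
          gcongr
          exact Finset.card_le_univ _
  · nlinarith [h j hj]

/-- If the second largest norm is below `C`, all vectors but one have norm below `C`. -/
lemma exists_forall_ne_zNorm_lt_of_mu2_lt {d q : ℕ} (hq : 0 < q) {k l : Fin q → Idx d} {C : ℝ}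
    (h : mu2 k l < C) :
    ∃ i : Fin q ⊕ Fin q, ∀ j, j ≠ i →
      Sum.elim (fun a => zNorm (k a)) (fun a => zNorm (l a)) j < C := by
  have : Nonempty (Fin q ⊕ Fin q) := ⟨Sum.inl ⟨0, hq⟩⟩
  obtain ⟨i, hi⟩ := exists_lt_of_ciInf_lt h
  refine ⟨i, fun j hj => lt_of_le_of_lt ?_ hi⟩
  exact le_ciSup (f := fun j : {j : Fin q ⊕ Fin q // j ≠ i} =>
    Sum.elim (fun a => zNorm (k a)) (fun a => zNorm (l a)) (j : Fin q ⊕ Fin q))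
    (Set.finite_range _).bddAbove ⟨j, hj⟩

/-- A block-unbalanced pair has a component outside the ball of radius two. -/
lemma Unbalanced.two_le_iSup {d q : ℕ} {k l : Fin q → Idx d} (h : Unbalanced k l) :
    2 ≤ ⨆ j : Fin q, max (zNorm (k j)) (zNorm (l j)) := by
  by_contra! hlt
  have hmax (j : Fin q) : max (zNorm (k j)) (zNorm (l j)) < 2 :=
    lt_of_le_of_lt (le_ciSup (f := fun j => max (zNorm (k j)) (zNorm (l j)))
      (Set.finite_range _).bddAbove j) hlt
  obtain ⟨n, hn⟩ := h
  have hk (j : Fin q) : blockIdx (k j) = 0 := if_pos (lt_of_le_of_lt (le_max_left _ _) (hmax j))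
  have hl (j : Fin q) : blockIdx (l j) = 0 := if_pos (lt_of_le_of_lt (le_max_right _ _) (hmax j))
  simp [hk, hl] at hn

/-- Lemma `outza` : if `V` is non-resonant, `N = 2^{n_max}`, `q ≥ 2`, `ν ∈ (0,1)` with
`γ q^{−4}(log₂(2qN))^{−(2q+1)} ≥ ν`, and `𝐤,𝐥` satisfy `|Ω(𝐤,𝐥)| < ν` and the zero
momentum condition, then either `μ₂(𝐤,𝐥) ≥ N` or `(𝐤,𝐥)` is block-balanced. -/
theorem small_divisor_dichotomy {d : ℕ} (V : Idx d → ℝ)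
    (hVbdd : ∃ M : ℝ, ∀ k, |V k| ≤ M) (γ : ℝ) (hγ : 0 < γ) (hNR : NonRes V γ)
    (nmax : ℕ) (hnmax : 1 ≤ nmax) (q : ℕ) (hq : 2 ≤ q)
    (ν : ℝ) (hν : ν ∈ Set.Ioo (0 : ℝ) 1)
    (hcfl : ν ≤ γ * ((q : ℝ) ^ 4)⁻¹ *
      (Real.logb 2 (2 * (q : ℝ) * (2 ^ nmax : ℕ))) ^ (-(2 * (q : ℝ) + 1)))
    (k l : Fin q → Idx d)
    (hsmall : |smallDiv (freqV V) k l| < ν)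
    (hmom : (∑ j, k j) = ∑ j, l j) :
    ((2 ^ nmax : ℕ) : ℝ) ≤ mu2 k l ∨ ¬ Unbalanced k l := by
  by_contra! hcon
  obtain ⟨hmu, hun⟩ := hcon
  obtain ⟨i, hi⟩ := exists_forall_ne_zNorm_lt_of_mu2_lt (by omega) hmu
  set w : Fin q ⊕ Fin q → Idx d := Sum.elim k fun a => -l a with hw
  have hnorm (j) : zNorm (w j) = Sum.elim (fun a => zNorm (k a)) (fun a => zNorm (l a)) j := by
    cases j <;> simp [hw, zNorm_neg]
  have hsum : ∑ j, w j = 0 := by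
    simp [hw, Fintype.sum_sum_type, hmom]
  have hbound (j) : zNorm (w j) ≤ 2 * (q : ℝ) * (2 ^ nmax : ℕ) := by
    refine (zNorm_le_card_mul_of_sum_eq_zero hsum (Nat.cast_nonneg (2 ^ nmax)) i
      (fun j hj => (hnorm j).trans_le (hi j hj).le) j).trans_eq ?_
    rw [Fintype.card_sum, Fintype.card_fin]
    push_cast
    ring
  have : Nonempty (Fin q) := ⟨⟨0, by omega⟩⟩
  have hsup : ⨆ j : Fin q, max (zNorm (k j)) (zNorm (l j)) ≤ 2 * (q : ℝ) * (2 ^ nmax : ℕ) := by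
    refine ciSup_le fun j => max_le ?_ ?_
    · simpa [hnorm] using hbound (Sum.inl j)
    · simpa [hnorm] using hbound (Sum.inr j)
  have htwo := hun.two_le_iSup
  have hlog : 0 < Real.logb 2 (⨆ j : Fin q, max (zNorm (k j)) (zNorm (l j))) :=
    Real.logb_pos one_lt_two (by linarith)
  have hpow := Real.rpow_le_rpow_of_nonpos hlog
    (Real.logb_le_logb_of_le one_lt_two (by linarith) hsup)
    (show -(2 * (q : ℝ) + 1) ≤ 0 by linarith [Nat.cast_nonneg (α := ℝ) q])
  have hdiv := hNR q hq k l hun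
  have hmono := mul_le_mul_of_nonneg_left hpow
    (show 0 ≤ γ * ((q : ℝ) ^ 4)⁻¹ by positivity)
  linarith
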